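/- Let Γ be an amply regular graph with parameters (v,k,λ,μ), smallest eigenvalue -m, having a maximal clique C of order c ≥ (m-1)(4m-1) with c - 1 < k, such that μ < (c+m-1+√D)/2 where D = (c+m-1)(c-(m-1)(4m-1)). Then (c+m-3)(k-c+1) - 2(c-1)(λ-c+2) ≥ (k-c+1)·√D. -/

import Mathlib

/-- Adding a constant that bounds the spectrum from below makes a Hermitian real matrix
positive semidefinite. -/
theorem Matrix.IsHermitian.posSemidef_add_smul_one {V : Type*} [Fintype V] [DecidableEq V]
    {A : Matrix V V ℝ} (hA : A.IsHermitian) {m : ℝ} (hm : -m ∈ lowerBounds (spectrum ℝ A)) :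
    (A + m • (1 : Matrix V V ℝ)).PosSemidef := by
  rw [Matrix.posSemidef_iff_isHermitian_and_spectrum_nonneg]
  refine ⟨hA.add (by simp [Matrix.IsHermitian]), fun x hx => ?_⟩
  have h : x - m ∈ spectrum ℝ A := by
    have e : A + m • (1 : Matrix V V ℝ) = algebraMap ℝ (Matrix V V ℝ) m + A := by
      rw [Algebra.algebraMap_eq_smul_one, add_comm]
    rw [e] at hx
    rw [← spectrum.add_mem_add_iff (s := m)]
    simpa [add_comm] using hx
  have := hm h
  simp only [Set.mem_ofPred_eq]
  linarith

namespace SimpleGraph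

open Finset

variable {V : Type*} [Fintype V] [DecidableEq V] (G : SimpleGraph V) [DecidableRel G.Adj]

/-- The quadratic form of `A + m` is nonnegative at vectors supported on a clique and one further
vertex. -/
theorem quadForm_clique_insert_nonneg {m : ℝ}
    (hm : -m ∈ lowerBounds (spectrum ℝ (G.adjMatrix ℝ)))
    {C : Finset V} (hC : G.IsClique (C : Set V)) {z : V} (hz : z ∉ C) (g : V → ℝ) (s : ℝ) :
    0 ≤ (∑ u ∈ C, g u) ^ 2 + (m - 1) * ∑ u ∈ C, g u ^ 2 +
      2 * s * ∑ u ∈ C with G.Adj z u, g u + m * s ^ 2 := by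
  have hpsd := (Matrix.IsHermitian.posSemidef_add_smul_one
    (show (G.adjMatrix ℝ).IsHermitian by simp [Matrix.IsHermitian]) hm)
  set f : V → ℝ := fun u => if u = z then s else if u ∈ C then g u else 0 with hf
  have hfz : f z = s := by simp [hf]
  have hfC : ∀ u ∈ C, f u = g u := fun u hu => by
    have : u ≠ z := fun h => hz (h ▸ hu)
    simp [hf, this, hu]
  have hsum : ∀ h : V → ℝ, ∑ u, f u * h u = s * h z + ∑ u ∈ C, g u * h u := by
    intro h
    rw [← Finset.sum_subset (Finset.subset_univ (insert z C)), Finset.sum_insert hz, hfz]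
    · congr 1
      exact Finset.sum_congr rfl fun u hu => by rw [hfC u hu]
    · intro u _ hu
      simp only [mem_insert, not_or] at hu
      simp [hf, hu.1, hu.2]
  have hAf : ∀ u, (G.adjMatrix ℝ).mulVec f u =
      s * (G.adjMatrix ℝ u z) + ∑ w ∈ C, g w * G.adjMatrix ℝ u w := by
    intro u
    rw [← hsum (fun w => G.adjMatrix ℝ u w)]
    simp only [Matrix.mulVec, dotProduct, mul_comm]
  have hAC : ∀ u ∈ C, ∑ w ∈ C, g w * G.adjMatrix ℝ u w = ∑ w ∈ C, g w - g u := by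
    intro u hu
    rw [← Finset.add_sum_erase _ _ hu, ← Finset.add_sum_erase C g hu]
    simp only [adjMatrix_apply, G.irrefl, if_false, mul_zero, zero_add, add_sub_cancel_left]
    refine Finset.sum_congr rfl fun w hw => ?_
    rw [if_pos (hC hu (mem_of_mem_erase hw) (ne_of_mem_erase hw).symm), mul_one]
  have hAz : ∑ u ∈ C, g u * G.adjMatrix ℝ z u = ∑ u ∈ C with G.Adj z u, g u := by
    simp [adjMatrix_apply, Finset.sum_filter]
  have h0 := hpsd.dotProduct_mulVec_nonneg f
  have hexp : star f ⬝ᵥ (G.adjMatrix ℝ + m • (1 : Matrix V V ℝ)).mulVec f =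
      ∑ u, f u * ((G.adjMatrix ℝ).mulVec f u + m * f u) := by
    simp [dotProduct, Matrix.add_mulVec, Matrix.smul_mulVec]
  rw [hexp, hsum, hAf, hAz, hfz] at h0
  have hlast : ∑ u ∈ C, g u * ((G.adjMatrix ℝ).mulVec f u + m * f u) =
      s * (∑ u ∈ C with G.Adj z u, g u) + (∑ u ∈ C, g u) ^ 2 + (m - 1) * ∑ u ∈ C, g u ^ 2 := by
    rw [← hAz, sq (∑ u ∈ C, g u), Finset.sum_mul, Finset.mul_sum, Finset.mul_sum,
      ← Finset.sum_add_distrib, ← Finset.sum_add_distrib]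
    refine Finset.sum_congr rfl fun u hu => ?_
    rw [hAf, hAC u hu, hfC u hu, (G.isSymm_adjMatrix).apply u z]
    ring
  rw [hlast] at h0
  simp only [adjMatrix_apply, G.irrefl, if_false] at h0
  linarith

/-- The quadratic form of `A + m` at a vector that is constant on the neighbours and on the
non-neighbours of `z` in a clique. -/
theorem quadForm_clique_partition_nonneg {m : ℝ}
    (hm : -m ∈ lowerBounds (spectrum ℝ (G.adjMatrix ℝ)))
    {C : Finset V} (hC : G.IsClique (C : Set V)) {z : V} (hz : z ∉ C) {t r : ℝ}
    (ht : (#{u ∈ C | G.Adj z u} : ℝ) = t) (hr : (#{u ∈ C | ¬G.Adj z u} : ℝ) = r) (p q s : ℝ) :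
    0 ≤ (t * p + r * q) ^ 2 + (m - 1) * (t * p ^ 2 + r * q ^ 2) + 2 * s * (t * p) +
      m * s ^ 2 := by
  have h := G.quadForm_clique_insert_nonneg hm hC hz (fun u => if G.Adj z u then p else q) s
  have h1 : ∑ u ∈ C, (if G.Adj z u then p else q) = t * p + r * q := by
    rw [Finset.sum_ite]; simp [ht, hr]
  have h2 : ∑ u ∈ C, (if G.Adj z u then p else q) ^ 2 = t * p ^ 2 + r * q ^ 2 := by
    simp only [ite_pow]; rw [Finset.sum_ite]; simp [ht, hr]
  have h3 : ∑ u ∈ C with G.Adj z u, (if G.Adj z u then p else q) = t * p := by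
    rw [Finset.sum_congr rfl fun u hu => if_pos (mem_filter.1 hu).2]; simp [ht]
  rwa [h1, h2, h3] at h

/-- If the least eigenvalue is at least `-m`, a vertex with `t` neighbours and some non-neighbour
in a clique of order `c` satisfies `t (c + m - 1 - t) ≤ m (m - 1) (c + m - 1)`, and `1 < m`. -/
theorem card_adj_clique_spectral_bound {m : ℝ}
    (hm : -m ∈ lowerBounds (spectrum ℝ (G.adjMatrix ℝ)))
    {C : Finset V} (hC : G.IsClique (C : Set V)) {z : V} (hz : z ∉ C) {t : ℝ}
    (ht : (#{u ∈ C | G.Adj z u} : ℝ) = t) (hadj : ∃ x ∈ C, G.Adj z x)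
    (hnadj : ∃ y ∈ C, ¬G.Adj z y) :
    1 < m ∧ t * ((#C : ℝ) + m - 1 - t) ≤ m * (m - 1) * ((#C : ℝ) + m - 1) := by
  obtain ⟨r, hr⟩ : ∃ r : ℝ, (#{u ∈ C | ¬G.Adj z u} : ℝ) = r := ⟨_, rfl⟩
  have hcard : (#C : ℝ) = t + r := by
    rw [← ht, ← hr]
    exact_mod_cast (Finset.card_filter_add_card_filter_not (s := C) (fun u => G.Adj z u)).symm
  have ht0 : 0 < t := by
    obtain ⟨x, hx, hzx⟩ := hadj
    rw [← ht]; exact_mod_cast Finset.card_pos.2 ⟨x, mem_filter.2 ⟨hx, hzx⟩⟩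
  have hr0 : 0 < r := by
    obtain ⟨y, hy, hzy⟩ := hnadj
    rw [← hr]; exact_mod_cast Finset.card_pos.2 ⟨y, mem_filter.2 ⟨hy, hzy⟩⟩
  have key := G.quadForm_clique_partition_nonneg hm hC hz ht hr
  have hm1 : 1 < m := by
    by_contra! hle
    have h := key (-r) t (r * t)
    have h1 : (m - 1) * (t * r ^ 2 + r * t ^ 2) ≤ 0 :=
      mul_nonpos_of_nonpos_of_nonneg (by linarith) (by positivity)
    have h2 : (m - 1) * (r * t) ^ 2 ≤ 0 :=
      mul_nonpos_of_nonpos_of_nonneg (by linarith) (by positivity)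
    have h3 : 0 < (r * t) ^ 2 := by positivity
    linarith
  refine ⟨hm1, ?_⟩
  rw [hcard]
  have h := key (-(r + m - 1)) t ((m - 1) * (t + r + m - 1))
  have hM : 0 < (m - 1) * (t + r + m - 1) := mul_pos (by linarith) (by linarith)
  have h' : 0 ≤ ((m - 1) * (t + r + m - 1)) *
      (m * (m - 1) * (t + r + m - 1) - t * (t + r + m - 1 - t)) := by
    convert h using 1; ring
  linarith [nonneg_of_mul_nonneg_right h' hM]

/-- Double counting edges between `C \ {x}` and `Γ(x) \ C`: some neighbour `z` of `x` outside the
clique `C` has, after discarding `x`, at least the average number of neighbours in `C`. -/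
theorem exists_adj_notMem_clique_card_ge {k lam : ℕ} (hreg : G.IsRegularOfDegree k)
    (hlam : ∀ u w : V, G.Adj u w → (G.neighborFinset u ∩ G.neighborFinset w).card = lam)
    {C : Finset V} (hC : G.IsClique (C : Set V)) {x : V} (hx : x ∈ C) (hck : #C - 1 < k) :
    ∃ z ∉ C, G.Adj z x ∧ ((#C : ℝ) - 1) * ((lam : ℝ) - #C + 2) ≤
      ((k : ℝ) - #C + 1) * ((#{u ∈ C | G.Adj z u} : ℝ) - 1) := by
  have hcpos : 0 < #C := Finset.card_pos.2 ⟨x, hx⟩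
  have hnbr : ∀ y ∈ C, C.erase y ⊆ G.neighborFinset y := fun y hy u hu => by
    rw [mem_neighborFinset]
    exact hC hy (mem_of_mem_erase hu) (ne_of_mem_erase hu).symm
  have hsplit : (G.neighborFinset x).filter (· ∈ C) = C.erase x := by
    ext u
    simp only [mem_filter, mem_erase]
    exact ⟨fun h => ⟨fun e => by simp [e] at h, h.2⟩,
      fun h => ⟨hnbr x hx (mem_erase.2 h), h.2⟩⟩
  set S := (G.neighborFinset x).filter (· ∉ C) with hS
  have hScard : (#S : ℝ) = (k : ℝ) - #C + 1 := by
    have h := Finset.card_filter_add_card_filter_not (s := G.neighborFinset x) (· ∈ C)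
    rw [hsplit, card_erase_of_mem hx, card_neighborFinset_eq_degree, hreg x] at h
    have : #S + #C = k + 1 := by simp only [hS]; omega
    have : (#S : ℝ) + #C = k + 1 := by exact_mod_cast this
    linarith
  have hSpos : S.Nonempty := by
    rw [← Finset.card_pos]
    have : (#C : ℝ) < k + 1 := by exact_mod_cast (by omega : #C < k + 1)
    have : (0 : ℝ) < #S := by rw [hScard]; linarith
    exact_mod_cast this
  have hrow : ∀ y ∈ C.erase x, (#{z ∈ S | G.Adj z y} : ℝ) = (lam : ℝ) - #C + 2 := by
    intro y hy
    obtain ⟨hyx, hyC⟩ := mem_erase.1 hy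
    have h := Finset.card_filter_add_card_filter_not
      (s := G.neighborFinset x ∩ G.neighborFinset y) (· ∈ C)
    rw [hlam x y (hC hx hyC hyx.symm)] at h
    have h1 : (G.neighborFinset x ∩ G.neighborFinset y).filter (· ∈ C) = (C.erase x).erase y := by
      ext u
      simp only [mem_filter, mem_inter, mem_erase, mem_neighborFinset]
      exact ⟨fun h => ⟨h.1.2.ne', h.1.1.ne', h.2⟩,
        fun h => ⟨⟨hC hx h.2.2 (Ne.symm h.2.1), hC hyC h.2.2 (Ne.symm h.1)⟩, h.2.2⟩⟩
    have h2 : (G.neighborFinset x ∩ G.neighborFinset y).filter (· ∉ C) =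
        {z ∈ S | G.Adj z y} := by
      ext u
      simp only [hS, mem_filter, mem_inter, mem_neighborFinset, G.adj_comm u y]
      tauto
    have hpos : 0 < #(C.erase x) := Finset.card_pos.2 ⟨y, hy⟩
    rw [card_erase_of_mem hx] at hpos
    rw [h1, h2, card_erase_of_mem hy, card_erase_of_mem hx] at h
    have : #{z ∈ S | G.Adj z y} + #C = lam + 2 := by omega
    have : (#{z ∈ S | G.Adj z y} : ℝ) + #C = lam + 2 := by exact_mod_cast this
    linarith
  have hcol : ∀ z ∈ S, (#{y ∈ C.erase x | G.Adj z y} : ℝ) = #{u ∈ C | G.Adj z u} - 1 := by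
    intro z hz
    have hzx : G.Adj z x := by
      simpa [hS, G.adj_comm x z] using (mem_filter.1 hz).1
    rw [Finset.filter_erase, cast_card_erase_of_mem (mem_filter.2 ⟨hx, hzx⟩)]
  have hdouble : ∑ z ∈ S, ((#{u ∈ C | G.Adj z u} : ℝ) - 1) =
      ((#C : ℝ) - 1) * ((lam : ℝ) - #C + 2) := by
    rw [← Finset.sum_congr rfl hcol]
    have h := Finset.sum_card_bipartiteAbove_eq_sum_card_bipartiteBelow
      (s := S) (t := C.erase x) G.Adj
    simp only [bipartiteAbove, bipartiteBelow] at h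
    have h' : ∑ z ∈ S, (#{y ∈ C.erase x | G.Adj z y} : ℝ) =
        ∑ y ∈ C.erase x, (#{z ∈ S | G.Adj z y} : ℝ) := by exact_mod_cast h
    rw [h', Finset.sum_congr rfl hrow, sum_const, nsmul_eq_mul, cast_card_erase_of_mem hx]
  obtain ⟨z, hz, hle⟩ : ∃ z ∈ S, ((#C : ℝ) - 1) * ((lam : ℝ) - #C + 2) ≤
      ((k : ℝ) - #C + 1) * ((#{u ∈ C | G.Adj z u} : ℝ) - 1) := by
    by_contra! hlt
    have h := Finset.sum_lt_sum_of_nonempty hSpos hlt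
    rw [← Finset.mul_sum, hdouble, sum_const, nsmul_eq_mul, hScard] at h
    exact lt_irrefl _ h
  have hz' := mem_filter.1 hz
  exact ⟨z, hz'.2, by simpa [G.adj_comm x z] using hz'.1, hle⟩

/-- When non-adjacent vertices with a common neighbour have exactly `μ` of them, a vertex outside
a clique with a neighbour and a non-neighbour in it has at most `μ` neighbours in it. -/
theorem card_adj_clique_le {μ : ℕ}
    (hμ : ∀ u w : V, u ≠ w → ¬G.Adj u w → (G.neighborFinset u ∩ G.neighborFinset w).Nonempty →
      (G.neighborFinset u ∩ G.neighborFinset w).card = μ)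
    {C : Finset V} (hC : G.IsClique (C : Set V)) {z : V} (hz : z ∉ C)
    (hadj : ∃ x ∈ C, G.Adj z x) (hnadj : ∃ y ∈ C, ¬G.Adj z y) :
    #{u ∈ C | G.Adj z u} ≤ μ := by
  obtain ⟨x, hx, hzx⟩ := hadj
  obtain ⟨y, hy, hzy⟩ := hnadj
  have hsub : {u ∈ C | G.Adj z u} ⊆ G.neighborFinset z ∩ G.neighborFinset y := by
    intro u hu
    obtain ⟨huC, hzu⟩ := mem_filter.1 hu
    simp only [mem_inter, mem_neighborFinset]
    exact ⟨hzu, hC hy huC fun e => hzy (e ▸ hzu)⟩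
  rw [← hμ z y (fun e => hz (e ▸ hy)) hzy ⟨x, hsub (mem_filter.2 ⟨hx, hzx⟩)⟩]
  exact card_le_card hsub

end SimpleGraph

/-- Lemma 3.6: let `Γ` be amply regular with parameters `(v,k,λ,μ)` and smallest adjacency
eigenvalue `-m`, having a maximal clique of order `c ≥ (m-1)(4m-1)` with `c - 1 < k`, such
that `μ < (c+m-1+√D)/2` where `D = (c+m-1)(c-(m-1)(4m-1))`. Then
`(c+m-3)(k-c+1) - 2(c-1)(λ-c+2) ≥ (k-c+1)·√D`. -/
theorem maximal_clique_sqrt_bound {V : Type*} [Fintype V] [DecidableEq V]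
    (G : SimpleGraph V) [DecidableRel G.Adj] (v k lam μ : ℕ) (m : ℝ)
    (hv : Fintype.card V = v)
    (hreg : G.IsRegularOfDegree k)
    (hlam : ∀ u w : V, G.Adj u w → (G.neighborFinset u ∩ G.neighborFinset w).card = lam)
    (hμ : ∀ u w : V, u ≠ w → ¬G.Adj u w → (G.neighborFinset u ∩ G.neighborFinset w).Nonempty →
      (G.neighborFinset u ∩ G.neighborFinset w).card = μ)
    (hspec : IsLeast (spectrum ℝ (G.adjMatrix ℝ)) (-m))
    (C : Finset V) (hclique : G.IsClique (C : Set V))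
    (hmax : ∀ y ∉ C, ∃ z ∈ C, ¬G.Adj y z)
    (c : ℕ) (hc : C.card = c) (hcm : (m - 1) * (4 * m - 1) ≤ (c : ℝ)) (hck : c - 1 < k)
    (hμsmall : (μ : ℝ) <
      ((c : ℝ) + m - 1 +
        Real.sqrt (((c : ℝ) + m - 1) * ((c : ℝ) - (m - 1) * (4 * m - 1)))) / 2) :
    ((k : ℝ) - c + 1) *
        Real.sqrt (((c : ℝ) + m - 1) * ((c : ℝ) - (m - 1) * (4 * m - 1))) ≤
      ((c : ℝ) + m - 3) * ((k : ℝ) - c + 1) - 2 * ((c : ℝ) - 1) * ((lam : ℝ) - c + 2) := by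
  subst hc
  have hCne : C.Nonempty := by
    rw [Finset.nonempty_iff_ne_empty]
    rintro rfl
    have : IsEmpty V := ⟨fun y => by simpa using hmax y (Finset.notMem_empty y)⟩
    have h := hspec.1
    rw [spectrum.of_subsingleton] at h
    exact h
  obtain ⟨x, hx⟩ := hCne
  obtain ⟨z, hz, hzx, hcount⟩ := G.exists_adj_notMem_clique_card_ge hreg hlam hclique hx hck
  have hadj : ∃ x ∈ C, G.Adj z x := ⟨x, hx, hzx⟩
  have hle := G.card_adj_clique_le hμ hclique hz hadj (hmax z hz)
  obtain ⟨hm1, hbound⟩ :=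
    G.card_adj_clique_spectral_bound hspec.2 hclique hz rfl hadj (hmax z hz)
  have hle' : ((C.filter (G.Adj z)).card : ℝ) ≤ μ := by exact_mod_cast hle
  have hpos : 0 < (k : ℝ) - C.card + 1 := by
    have : (C.card : ℝ) < k + 1 := by exact_mod_cast (by omega : C.card < k + 1)
    linarith
  have hcnn : (0 : ℝ) ≤ C.card := Nat.cast_nonneg _
  have hD : 0 ≤ ((C.card : ℝ) + m - 1) * ((C.card : ℝ) - (m - 1) * (4 * m - 1)) :=
    mul_nonneg (by linarith) (by linarith)
  have hsq := Real.sq_sqrt hD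
  have hnn := Real.sqrt_nonneg (((C.card : ℝ) + m - 1) * ((C.card : ℝ) - (m - 1) * (4 * m - 1)))
  set R := Real.sqrt (((C.card : ℝ) + m - 1) * ((C.card : ℝ) - (m - 1) * (4 * m - 1)))
  set t : ℝ := ((C.filter (G.Adj z)).card : ℝ)
  have hroot : 2 * t ≤ (C.card : ℝ) + m - 1 - R := by
    by_contra! h
    have : 0 < (2 * t - (C.card + m - 1 - R)) * (C.card + m - 1 + R - 2 * t) :=
      mul_pos (by linarith) (by linarith)
    nlinarith
  have := mul_le_mul_of_nonneg_left hroot hpos.le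
  linarith
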